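/- arXiv:2410.14697 — 6 statements merged into one kernel-verified Lean document; each statement's English description precedes it below -/
import Mathlib

section
/- Assume additionally that pz z > 0 for every z ∈ Z and that the family of functions (y ↦ ρY(y, z))_{z ∈ Z} is linearly independent in Y → ℝ. Then for every z₀ ∈ Z, the function x ↦ ρX(x, z₀) lies in the linear span (over ℝ) of the set of functions { x ↦ ρ(x, y) : y ∈ Y } in X → ℝ. -/
open scoped BigOperators

/-- If in addition pz z > 0 for every z and the family (y ↦ ρY(y, z))_z is
linearly independent in Y → ℝ, then for every z₀ the function x ↦ ρX(x, z₀) lies in the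
ℝ-linear span of { x ↦ ρ(x, y) : y ∈ Y }. -/
theorem factor_ratio_in_span_of_density_ratios
    {Z X Y : Type*} [Fintype Z] [Fintype X] [Fintype Y]
    [Nonempty Z] [Nonempty X] [Nonempty Y]
    (pz : Z → ℝ) (pXc : Z → X → ℝ) (pYc : Z → Y → ℝ)
    (hpz_nonneg : ∀ z, 0 ≤ pz z) (hpz_sum : ∑ z, pz z = 1)
    (hpXc_nonneg : ∀ z x, 0 ≤ pXc z x) (hpXc_sum : ∀ z, ∑ x, pXc z x = 1)
    (hpYc_nonneg : ∀ z y, 0 ≤ pYc z y) (hpYc_sum : ∀ z, ∑ y, pYc z y = 1)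
    (p : X → Y → ℝ) (hp : ∀ x y, p x y = ∑ z, pz z * pXc z x * pYc z y)
    (pXm : X → ℝ) (hpXm : ∀ x, pXm x = ∑ z, pz z * pXc z x)
    (pYm : Y → ℝ) (hpYm : ∀ y, pYm y = ∑ z, pz z * pYc z y)
    (hpXm_pos : ∀ x, 0 < pXm x) (hpYm_pos : ∀ y, 0 < pYm y)
    (ρ : X → Y → ℝ) (hρ : ∀ x y, ρ x y = p x y / (pXm x * pYm y))
    (ρX : X → Z → ℝ) (hρX : ∀ x z, ρX x z = pXc z x / pXm x)
    (ρY : Y → Z → ℝ) (hρY : ∀ y z, ρY y z = pYc z y / pYm y)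
    (hpz_pos : ∀ z, 0 < pz z)
    (hlin : LinearIndependent ℝ (fun z : Z => fun y : Y => ρY y z)) :
    ∀ z₀ : Z, (fun x : X => ρX x z₀) ∈
      Submodule.span ℝ (Set.range fun y : Y => fun x : X => ρ x y) := by

  classical
  intro z₀
  obtain ⟨f, hf⟩ := LinearMap.exists_extend ((Finsupp.lapply z₀ : (Z →₀ ℝ) →ₗ[ℝ] ℝ).comp hlin.repr)
  have hfz : ∀ z, f (fun y => ρY y z) = if z = z₀ then 1 else 0 := by
    intro z
    have h := LinearMap.congr_fun hf ⟨(fun y => ρY y z), Submodule.subset_span ⟨z, rfl⟩⟩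
    have h2 := hlin.repr_eq_single z ⟨(fun y => ρY y z), Submodule.subset_span ⟨z, rfl⟩⟩ rfl
    simp only [LinearMap.comp_apply, Submodule.subtype_apply] at h
    rw [h]
    erw [h2]
    simp [Finsupp.single_apply]
  have hsum : ∀ z, ∑ y, ρY y z * f (fun j => if y = j then 1 else 0) = if z = z₀ then 1 else 0 := by
    intro z
    rw [← hfz z, LinearMap.pi_apply_eq_sum_univ f (fun y => ρY y z)]
    simp
  have hfac : ∀ x y, ρ x y = ∑ z, pz z * ρX x z * ρY y z := by
    intro x y
    rw [hρ, hp, Finset.sum_div]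
    refine Finset.sum_congr rfl fun z _ => ?_
    rw [hρX, hρY]
    have := (hpXm_pos x).ne'
    have := (hpYm_pos y).ne'
    field_simp
  have key : (fun x => ρX x z₀) = (pz z₀)⁻¹ • ∑ y, f (fun j => if y = j then 1 else 0) • (fun x => ρ x y) := by
    funext x
    have h1 : ∑ y, f (fun j => if y = j then 1 else 0) * ρ x y = pz z₀ * ρX x z₀ := by
      calc _ = ∑ z, pz z * ρX x z * ∑ y, ρY y z * f (fun j => if y = j then 1 else 0) := by
            simp only [hfac, Finset.mul_sum]
            rw [Finset.sum_comm]
            refine Finset.sum_congr rfl fun z _ => Finset.sum_congr rfl fun y _ => by ring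
        _ = _ := by simp [hsum]
    simp only [Pi.smul_apply, Finset.sum_apply, smul_eq_mul]
    rw [h1]
    have := (hpz_pos z₀).ne'
    field_simp
  rw [key]
  exact Submodule.smul_mem _ _ (Submodule.sum_mem _ fun y _ => Submodule.smul_mem _ _ (Submodule.subset_span ⟨y, rfl⟩))
end

section
/- If the block matrix R_FG = fromBlocks R_F P Pᵀ R_G is positive semidefinite, then the trace cost is bounded: 0 ≤ trace (R_F⁻¹ * P * R_G⁻¹ * Pᵀ) ≤ K. -/
open Matrix

lemma aux_trace {K : ℕ} (A B : Matrix (Fin K) (Fin K) ℝ) (hA : A.PosSemidef) (hB : B.PosSemidef) :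
    0 ≤ (A * B).trace := by
  obtain ⟨C, rfl⟩ : ∃ C : Matrix (Fin K) (Fin K) ℝ, A = Cᴴ * C := by
    open scoped MatrixOrder Matrix.Norms.L2Operator in
    exact CStarAlgebra.nonneg_iff_eq_star_mul_self.mp hA.nonneg
  rw [Matrix.mul_assoc, Matrix.trace_mul_comm]
  exact (hB.mul_mul_conjTranspose_same C).trace_nonneg

/-- If fromBlocks R_F P Pᵀ R_G is positive semidefinite, then
0 ≤ trace (R_F⁻¹ * P * R_G⁻¹ * Pᵀ) ≤ K. -/
theorem trace_cost_bounds
    {K : ℕ} (hK : 0 < K)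
    (R_F R_G P : Matrix (Fin K) (Fin K) ℝ)
    (hRF : R_F.PosDef) (hRG : R_G.PosDef)
    (hFG : (Matrix.fromBlocks R_F P Pᵀ R_G).PosSemidef) :
    0 ≤ (R_F⁻¹ * P * R_G⁻¹ * Pᵀ).trace ∧ (R_F⁻¹ * P * R_G⁻¹ * Pᵀ).trace ≤ (K : ℝ) := by
  have hT : Pᴴ = Pᵀ := Matrix.conjTranspose_eq_transpose_of_trivial P
  have hu : IsUnit R_F.det := (Matrix.isUnit_iff_isUnit_det _).mp hRF.isUnit
  have : Invertible R_G := hRG.isUnit.invertible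
  have h1 : (R_F - P * R_G⁻¹ * Pᵀ).PosSemidef := by
    rw [← hT] at hFG ⊢
    exact (Matrix.PosDef.fromBlocks₂₂ R_F P hRG).mp hFG
  have h2 : (P * R_G⁻¹ * Pᵀ).PosSemidef := by
    rw [← hT]
    exact hRG.inv.posSemidef.mul_mul_conjTranspose_same P
  have e : R_F⁻¹ * P * R_G⁻¹ * Pᵀ = R_F⁻¹ * (P * R_G⁻¹ * Pᵀ) := by
    simp only [Matrix.mul_assoc]
  rw [e]
  refine ⟨aux_trace _ _ hRF.inv.posSemidef h2, ?_⟩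
  have h3 := aux_trace _ _ hRF.inv.posSemidef h1
  rw [Matrix.mul_sub, Matrix.nonsing_inv_mul _ hu, Matrix.trace_sub, Matrix.trace_one,
    Fintype.card_fin] at h3
  linarith
end

section
/- (Ky Fan maximum principle.) Let A : Matrix (Fin n) (Fin n) ℝ be a real symmetric matrix, let K ≤ n, and let V : Matrix (Fin n) (Fin K) ℝ satisfy Vᵀ * V = 1 (the K × K identity), i.e., V has orthonormal columns. Then trace (Vᵀ * A * V) ≤ Σ_{k=1}^{K} μ_k, where μ_1 ≥ μ_2 ≥ … ≥ μ_n are the eigenvalues of A listed in decreasing order with multiplicity. -/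
open Matrix

lemma kf_weights {K m : ℕ} (μ : Fin (K + m) → ℝ) (hμ : Antitone μ) (d : Fin (K + m) → ℝ)
    (h0 : ∀ i, 0 ≤ d i) (h1 : ∀ i, d i ≤ 1) (hs : ∑ i, d i = K) :
    ∑ i, μ i * d i ≤ ∑ k : Fin K, μ (Fin.castAdd m k) := by
  rcases Nat.eq_zero_or_pos K with rfl | hK
  · have h : ∀ i, d i = 0 := by
      intro i
      have := (Finset.sum_eq_zero_iff_of_nonneg (fun i _ => h0 i)).1 (by simpa using hs)
      exact this i (Finset.mem_univ _)
    simp [h]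
  · set t := μ ⟨K - 1, by omega⟩ with ht
    have key : ∑ i, (μ i - t) * d i ≤ ∑ k : Fin K, (μ (Fin.castAdd m k) - t) := by
      rw [Fin.sum_univ_add]
      have a : ∑ k : Fin K, (μ (Fin.castAdd m k) - t) * d (Fin.castAdd m k)
          ≤ ∑ k : Fin K, (μ (Fin.castAdd m k) - t) := by
        apply Finset.sum_le_sum
        intro k _
        have : t ≤ μ (Fin.castAdd m k) := hμ (by
          rw [Fin.le_def]; simp; omega)
        exact mul_le_of_le_one_right (by linarith) (h1 _)
      have b : ∑ k : Fin m, (μ (Fin.natAdd K k) - t) * d (Fin.natAdd K k) ≤ 0 := by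
        apply Finset.sum_nonpos
        intro k _
        have : μ (Fin.natAdd K k) ≤ t := hμ (by
          rw [Fin.le_def]; simp; omega)
        exact mul_nonpos_of_nonpos_of_nonneg (by linarith) (h0 _)
      linarith
    simp only [sub_mul, Finset.sum_sub_distrib, ← Finset.mul_sum, hs] at key
    simp at key
    linarith

lemma kf_diag_le {n K : ℕ} (W : Matrix (Fin n) (Fin K) ℝ) (hW : Wᵀ * W = 1) (i : Fin n) :
    (W * Wᵀ) i i ≤ 1 := by
  have hP : (W * Wᵀ) * (W * Wᵀ)ᵀ = W * Wᵀ := by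
    rw [transpose_mul, transpose_transpose, Matrix.mul_assoc, ← Matrix.mul_assoc Wᵀ, hW,
      Matrix.one_mul]
  generalize W * Wᵀ = P at hP
  have h := congrFun (congrFun hP i) i
  rw [Matrix.mul_apply] at h
  have h2 := Finset.single_le_sum (f := fun j => P i j * Pᵀ j i)
    (fun j _ => mul_self_nonneg (P i j)) (Finset.mem_univ i)
  simp only [transpose_apply] at h h2
  nlinarith

/-- Ky Fan maximum principle: For a real symmetric A and V with orthonormal
columns (Vᵀ * V = 1), trace (Vᵀ * A * V) ≤ Σ_{k<K} μ_k, where μ is the decreasing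
rearrangement (with multiplicity) of the eigenvalues of A. -/
theorem ky_fan_maximum_principle
    {n K : ℕ} (hK : K ≤ n)
    (A : Matrix (Fin n) (Fin n) ℝ) (hA : A.IsHermitian)
    (V : Matrix (Fin n) (Fin K) ℝ) (hV : Vᵀ * V = 1)
    (μ : Fin n → ℝ) (hμ_anti : Antitone μ)
    (σ : Equiv.Perm (Fin n)) (hμσ : μ = hA.eigenvalues ∘ σ) :
    (Vᵀ * A * V).trace ≤ ∑ k : Fin K, μ (Fin.castLE hK k) := by
  obtain ⟨U, hU, hAU⟩ : ∃ U : Matrix (Fin n) (Fin n) ℝ, U * Uᵀ = 1 ∧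
      A = U * diagonal hA.eigenvalues * Uᵀ := by
    refine ⟨hA.eigenvectorUnitary, ?_, ?_⟩
    · have := Unitary.coe_mul_star_self hA.eigenvectorUnitary
      rwa [Unitary.coe_star, star_eq_conjTranspose, conjTranspose_eq_transpose_of_trivial] at this
    · have := hA.spectral_theorem
      rw [Unitary.conjStarAlgAut_apply, star_eq_conjTranspose,
        conjTranspose_eq_transpose_of_trivial] at this
      exact this
  have hW : (Uᵀ * V)ᵀ * (Uᵀ * V) = 1 := by
    rw [transpose_mul, transpose_transpose, Matrix.mul_assoc, ← Matrix.mul_assoc U, hU,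
      Matrix.one_mul, hV]
  have htr : (Vᵀ * A * V).trace
      = (diagonal hA.eigenvalues * ((Uᵀ * V) * (Uᵀ * V)ᵀ)).trace := by
    have e : Vᵀ * A * V = (Uᵀ * V)ᵀ * (diagonal hA.eigenvalues * (Uᵀ * V)) := by
      rw [transpose_mul, transpose_transpose]
      conv_lhs => rw [hAU]
      simp only [Matrix.mul_assoc]
    rw [e, trace_mul_comm, Matrix.mul_assoc]
  generalize Uᵀ * V = W at hW htr
  have hs : ∑ i, (W * Wᵀ) (σ i) (σ i) = K := by
    rw [Equiv.sum_comp σ (fun i => (W * Wᵀ) i i)]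
    change (W * Wᵀ).trace = K
    rw [trace_mul_comm, hW]; simp
  have htr2 : (Vᵀ * A * V).trace = ∑ i, μ i * (W * Wᵀ) (σ i) (σ i) := by
    rw [htr, hμσ]
    simp only [Function.comp]
    rw [Equiv.sum_comp σ (fun i => hA.eigenvalues i * (W * Wᵀ) i i)]
    simp [trace, diagonal_mul]
  rw [htr2]
  have h1 : ∀ i, (W * Wᵀ) (σ i) (σ i) ≤ 1 := fun i => kf_diag_le W hW _
  have h0 : ∀ i, 0 ≤ (W * Wᵀ) (σ i) (σ i) := fun i => by
    rw [Matrix.mul_apply]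
    exact Finset.sum_nonneg (fun j _ => mul_self_nonneg (W (σ i) j))
  clear htr htr2 hμσ
  obtain ⟨m, rfl⟩ := Nat.exists_eq_add_of_le hK
  exact kf_weights μ hμ_anti _ h0 h1 hs
end

section
/- For any feature maps F : X → (Fin K → ℝ) and G : Y → (Fin K → ℝ) such that R_F and R_G are invertible, the trace cost is bounded by the dominant spectrum of the density-ratio kernel: trace (R_F⁻¹ * P_FG * R_G⁻¹ * P_FGᵀ) ≤ the sum of the min(K, |X|) largest eigenvalues of the real symmetric matrix Q * Qᵀ. -/
open Matrix

lemma aux_proj {n : Type*} [Fintype n] [DecidableEq n] {K : ℕ} (A : Matrix n (Fin K) ℝ)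
    (R : Matrix (Fin K) (Fin K) ℝ) (hR : R = Aᵀ * A) (hu : IsUnit R.det) :
    (A * R⁻¹ * Aᵀ)ᵀ = A * R⁻¹ * Aᵀ ∧ (A * R⁻¹ * Aᵀ) * (A * R⁻¹ * Aᵀ) = A * R⁻¹ * Aᵀ ∧
      (A * R⁻¹ * Aᵀ).trace = K := by
  have hRt : Rᵀ = R := by rw [hR]; simp [Matrix.transpose_mul]
  refine ⟨?_, ?_, ?_⟩
  · simp [Matrix.transpose_mul, Matrix.transpose_nonsing_inv, hRt, Matrix.mul_assoc]
  · calc (A * R⁻¹ * Aᵀ) * (A * R⁻¹ * Aᵀ) = A * R⁻¹ * (Aᵀ * A) * R⁻¹ * Aᵀ := by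
          simp only [Matrix.mul_assoc]
      _ = A * (R⁻¹ * R) * R⁻¹ * Aᵀ := by rw [← hR]; simp only [Matrix.mul_assoc]
      _ = _ := by rw [Matrix.nonsing_inv_mul _ hu, Matrix.mul_one]
  · rw [Matrix.trace_mul_comm, ← Matrix.mul_assoc, ← hR, Matrix.mul_nonsing_inv _ hu]
    simp

lemma aux_diag {n : Type*} [Fintype n] (S : Matrix n n ℝ) (h1 : Sᵀ = S)
    (h2 : S * S = S) (i : n) : 0 ≤ S i i ∧ S i i ≤ 1 := by
  have h : S i i = ∑ j, S i j ^ 2 := by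
    conv_lhs => rw [← h2, Matrix.mul_apply]
    refine Finset.sum_congr rfl fun j _ => ?_
    have : S j i = S i j := congrFun (congrFun h1 i) j
    rw [this, sq]
  have h3 : S i i ^ 2 ≤ S i i := by
    conv_rhs => rw [h]
    exact Finset.single_le_sum (f := fun j => S i j ^ 2) (fun j _ => sq_nonneg _)
      (Finset.mem_univ i)
  constructor
  · rw [h]; exact Finset.sum_nonneg fun j _ => sq_nonneg _
  · nlinarith

lemma aux_sum {N K : ℕ} (μ w : Fin N → ℝ) (hμ : Antitone μ) (h0 : ∀ k, 0 ≤ w k)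
    (h1 : ∀ k, w k ≤ 1) (hs : ∑ k, w k = K) :
    ∑ k, μ k * w k ≤ ∑ k ∈ Finset.univ.filter (fun k : Fin N => (k : ℕ) < min K N), μ k := by
  have hKN : K ≤ N := by
    have : ∑ k, w k ≤ ∑ k : Fin N, (1 : ℝ) := Finset.sum_le_sum fun k _ => h1 k
    rw [hs] at this
    simpa using this
  rw [min_eq_left hKN]
  rcases Nat.eq_zero_or_pos K with rfl | hK
  · have : ∀ k, w k = 0 := fun k =>
      (Finset.sum_eq_zero_iff_of_nonneg (fun k _ => h0 k)).1 (by simpa using hs) k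
        (Finset.mem_univ k)
    simp [this]
  · let k0 : Fin N := ⟨K - 1, by omega⟩
    have hc : ∑ k : Fin N, (if (k : ℕ) < K then (1 : ℝ) else 0) = K := by
      rw [Finset.sum_boole, Fin.card_filter_val_lt, min_eq_right hKN]
    have key : 0 ≤ ∑ k : Fin N, ((if (k : ℕ) < K then (1 : ℝ) else 0) - w k) * (μ k - μ k0) := by
      refine Finset.sum_nonneg fun k _ => ?_
      split_ifs with h
      · have : μ k0 ≤ μ k := hμ (by rw [Fin.le_def]; simp only [k0]; omega)
        exact mul_nonneg (by linarith [h1 k]) (by linarith)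
      · have : μ k ≤ μ k0 := hμ (by rw [Fin.le_def]; simp only [k0]; omega)
        exact mul_nonneg_of_nonpos_of_nonpos (by linarith [h0 k]) (by linarith)
    have e1 : ∑ k : Fin N, ((if (k : ℕ) < K then (1 : ℝ) else 0) - w k) * (μ k - μ k0)
        = (∑ k : Fin N, (if (k : ℕ) < K then μ k else 0)) - ∑ k, μ k * w k
          - ((∑ k : Fin N, (if (k : ℕ) < K then (1 : ℝ) else 0)) - ∑ k, w k) * μ k0 := by
      rw [← Finset.sum_sub_distrib, ← Finset.sum_sub_distrib, Finset.sum_mul,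
        ← Finset.sum_sub_distrib]
      refine Finset.sum_congr rfl fun k _ => ?_
      split_ifs <;> ring
    rw [e1, hc, hs] at key
    rw [Finset.sum_filter]
    linarith

/-- For any feature maps F, G with R_F and R_G invertible, the trace cost is
bounded by the sum of the min(K, |X|) largest eigenvalues of Q * Qᵀ. -/
theorem trace_cost_le_sum_top_eigenvalues
    {X Y : Type*} [Fintype X] [Fintype Y] [DecidableEq X] [DecidableEq Y]
    [Nonempty X] [Nonempty Y]
    (p : X → Y → ℝ) (hp_nonneg : ∀ x y, 0 ≤ p x y) (hp_sum : ∑ x, ∑ y, p x y = 1)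
    (pX : X → ℝ) (hpX : ∀ x, pX x = ∑ y, p x y)
    (pY : Y → ℝ) (hpY : ∀ y, pY y = ∑ x, p x y)
    (hpX_pos : ∀ x, 0 < pX x) (hpY_pos : ∀ y, 0 < pY y)
    (Q : Matrix X Y ℝ) (hQ : ∀ x y, Q x y = p x y / (Real.sqrt (pX x) * Real.sqrt (pY y)))
    {K : ℕ}
    (F : X → Fin K → ℝ) (G : Y → Fin K → ℝ)
    (R_F : Matrix (Fin K) (Fin K) ℝ) (hRF : ∀ i j, R_F i j = ∑ x, pX x * F x i * F x j)
    (R_G : Matrix (Fin K) (Fin K) ℝ) (hRG : ∀ i j, R_G i j = ∑ y, pY y * G y i * G y j)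
    (P_FG : Matrix (Fin K) (Fin K) ℝ)
    (hPFG : ∀ i j, P_FG i j = ∑ x, ∑ y, p x y * F x i * G y j)
    (hRF_inv : IsUnit R_F.det) (hRG_inv : IsUnit R_G.det)
    (hQQ : (Q * Qᵀ).IsHermitian)
    (μ : Fin (Fintype.card X) → ℝ) (hμ_anti : Antitone μ)
    (e : X ≃ Fin (Fintype.card X)) (hμe : hQQ.eigenvalues = μ ∘ e) :
    (R_F⁻¹ * P_FG * R_G⁻¹ * P_FGᵀ).trace ≤
      ∑ k ∈ Finset.univ.filter
        (fun k : Fin (Fintype.card X) => (k : ℕ) < min K (Fintype.card X)), μ k := by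
  let A : Matrix X (Fin K) ℝ := Matrix.of fun x i => Real.sqrt (pX x) * F x i
  let B : Matrix Y (Fin K) ℝ := Matrix.of fun y i => Real.sqrt (pY y) * G y i
  have hA : R_F = Aᵀ * A := by
    ext i j
    rw [hRF, Matrix.mul_apply]
    refine Finset.sum_congr rfl fun x _ => ?_
    have := Real.mul_self_sqrt (hpX_pos x).le
    simp only [A, Matrix.transpose_apply, Matrix.of_apply]
    linear_combination (-(F x i * F x j)) * this
  have hB : R_G = Bᵀ * B := by
    ext i j
    rw [hRG, Matrix.mul_apply]
    refine Finset.sum_congr rfl fun x _ => ?_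
    have := Real.mul_self_sqrt (hpY_pos x).le
    simp only [B, Matrix.transpose_apply, Matrix.of_apply]
    linear_combination (-(G x i * G x j)) * this
  have hP : P_FG = Aᵀ * Q * B := by
    ext i j
    rw [hPFG, Matrix.mul_apply, Finset.sum_comm]
    refine Finset.sum_congr rfl fun y _ => ?_
    rw [Matrix.mul_apply, Finset.sum_mul]
    refine Finset.sum_congr rfl fun x _ => ?_
    have h1 := (Real.sqrt_pos.2 (hpX_pos x)).ne'
    have h2 := (Real.sqrt_pos.2 (hpY_pos y)).ne'
    simp only [A, B, Matrix.transpose_apply, Matrix.of_apply, hQ]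
    field_simp
  obtain ⟨a1, a2, a3⟩ := aux_proj A R_F hA hRF_inv
  obtain ⟨b1, b2, -⟩ := aux_proj B R_G hB hRG_inv
  have ht : (R_F⁻¹ * P_FG * R_G⁻¹ * P_FGᵀ).trace
      = ((A * R_F⁻¹ * Aᵀ) * (Q * (B * R_G⁻¹ * Bᵀ) * Qᵀ)).trace := by
    have : (A * R_F⁻¹ * Aᵀ) * (Q * (B * R_G⁻¹ * Bᵀ) * Qᵀ)
        = A * (R_F⁻¹ * Aᵀ * (Q * (B * R_G⁻¹ * Bᵀ) * Qᵀ)) := by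
      simp only [Matrix.mul_assoc]
    rw [this, Matrix.trace_mul_comm A, hP]
    simp only [Matrix.transpose_mul, Matrix.transpose_transpose, Matrix.mul_assoc]
  rw [ht]
  generalize A * R_F⁻¹ * Aᵀ = S at *
  generalize B * R_G⁻¹ * Bᵀ = T at *
  have hle : (S * (Q * T * Qᵀ)).trace ≤ (S * (Q * Qᵀ)).trace := by
    have hN : 0 ≤ ((S * Q * (1 - T)) * (S * Q * (1 - T))ᵀ).trace := by
      rw [Matrix.trace]
      refine Finset.sum_nonneg fun i _ => ?_
      rw [Matrix.diag_apply, Matrix.mul_apply]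
      exact Finset.sum_nonneg fun j _ => mul_self_nonneg _
    have hT : (1 - T) * (1 - T) = 1 - T := by
      rw [Matrix.sub_mul, Matrix.mul_sub T, b2]; simp
    have e1 : (S * Q * (1 - T)) * (S * Q * (1 - T))ᵀ = S * (Q * (1 - T) * Qᵀ) * S := by
      rw [Matrix.transpose_mul, Matrix.transpose_mul, Matrix.transpose_sub, b1, a1,
        Matrix.transpose_one]
      calc _ = S * Q * ((1 - T) * (1 - T)) * (Qᵀ * S) := by simp only [Matrix.mul_assoc]
        _ = _ := by rw [hT]; simp only [Matrix.mul_assoc]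
    rw [e1, Matrix.trace_mul_comm, ← Matrix.mul_assoc, a2, Matrix.mul_sub, Matrix.sub_mul,
      Matrix.mul_sub, Matrix.trace_sub, Matrix.mul_one] at hN
    linarith
  refine hle.trans ?_
  let U : Matrix X X ℝ := hQQ.eigenvectorUnitary
  have hU1 : U * Uᵀ = 1 := by
    have := Unitary.coe_mul_star_self hQQ.eigenvectorUnitary
    simpa [U, Matrix.star_eq_conjTranspose] using this
  have hsp : Q * Qᵀ = U * Matrix.diagonal hQQ.eigenvalues * Uᵀ := by
    have := hQQ.spectral_theorem
    rw [Unitary.conjStarAlgAut_apply] at this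
    simpa [U, Matrix.star_eq_conjTranspose, Function.comp_def] using this
  have c1 : (Uᵀ * S * U)ᵀ = Uᵀ * S * U := by
    simp [Matrix.transpose_mul, a1, Matrix.mul_assoc]
  have c2 : (Uᵀ * S * U) * (Uᵀ * S * U) = Uᵀ * S * U := by
    calc _ = Uᵀ * S * (U * Uᵀ) * S * U := by simp only [Matrix.mul_assoc]
      _ = Uᵀ * (S * S) * U := by rw [hU1]; simp only [Matrix.mul_assoc, Matrix.one_mul]
      _ = _ := by rw [a2]
  have c3 : (Uᵀ * S * U).trace = K := by
    rw [Matrix.trace_mul_comm, ← Matrix.mul_assoc, hU1, Matrix.one_mul, a3]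
  have c4 : (S * (Q * Qᵀ)).trace = (Matrix.diagonal hQQ.eigenvalues * (Uᵀ * S * U)).trace := by
    rw [congrArg (fun M => (S * M).trace) hsp, Matrix.trace_mul_comm S]
    have : U * Matrix.diagonal hQQ.eigenvalues * Uᵀ * S
        = U * (Matrix.diagonal hQQ.eigenvalues * Uᵀ * S) := by simp only [Matrix.mul_assoc]
    rw [this, Matrix.trace_mul_comm U]
    simp only [Matrix.mul_assoc]
  rw [c4]
  generalize Uᵀ * S * U = W at *
  have h := aux_sum (K := K) μ (fun k => W (e.symm k) (e.symm k)) hμ_anti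
    (fun k => (aux_diag W c1 c2 _).1) (fun k => (aux_diag W c1 c2 _).2)
    (by rw [← c3, Matrix.trace]; exact e.symm.sum_comp (fun x => W x x))
  refine le_trans (le_of_eq ?_) h
  rw [Matrix.trace, ← e.symm.sum_comp]
  refine Finset.sum_congr rfl fun k _ => ?_
  rw [Matrix.diag_apply, Matrix.diagonal_mul, hμe]
  simp
end

section
/- If K ≤ |X| and K ≤ |Y|, then the bound in the trace-cost inequality is attained: there exist feature maps F : X → (Fin K → ℝ) and G : Y → (Fin K → ℝ) such that R_F and R_G are invertible and trace (R_F⁻¹ * P_FG * R_G⁻¹ * P_FGᵀ) equals the sum of the K largest eigenvalues of Q * Qᵀ. -/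
open Matrix

lemma sum_castLE_aux {K n : ℕ} (h : K ≤ n) (g : Fin n → ℝ) :
    ∑ i : Fin K, g (Fin.castLE h i) = ∑ k : Fin n, if (k : ℕ) < K then g k else 0 := by
  rw [← Finset.sum_filter]
  refine Finset.sum_bij (fun i _ => Fin.castLE h i) ?_ ?_ ?_ ?_
  · intro i _
    simp
  · intro i _ j _ hij
    simpa using hij
  · intro k hk
    exact ⟨⟨k, by simpa using hk⟩, by simp, by simp⟩
  · intro i _
    rfl

/-- If K ≤ |X| and K ≤ |Y|, the trace-cost bound is attained: there exist
feature maps F, G with R_F, R_G invertible and trace (R_F⁻¹ * P_FG * R_G⁻¹ * P_FGᵀ) equal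
to the sum of the K largest eigenvalues of Q * Qᵀ. -/
theorem trace_cost_bound_attained
    {X Y : Type*} [Fintype X] [Fintype Y] [DecidableEq X] [DecidableEq Y]
    [Nonempty X] [Nonempty Y]
    (p : X → Y → ℝ) (hp_nonneg : ∀ x y, 0 ≤ p x y) (hp_sum : ∑ x, ∑ y, p x y = 1)
    (pX : X → ℝ) (hpX : ∀ x, pX x = ∑ y, p x y)
    (pY : Y → ℝ) (hpY : ∀ y, pY y = ∑ x, p x y)
    (hpX_pos : ∀ x, 0 < pX x) (hpY_pos : ∀ y, 0 < pY y)
    (Q : Matrix X Y ℝ) (hQ : ∀ x y, Q x y = p x y / (Real.sqrt (pX x) * Real.sqrt (pY y)))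
    {K : ℕ} (hKX : K ≤ Fintype.card X) (hKY : K ≤ Fintype.card Y)
    (hQQ : (Q * Qᵀ).IsHermitian)
    (μ : Fin (Fintype.card X) → ℝ) (hμ_anti : Antitone μ)
    (e : X ≃ Fin (Fintype.card X)) (hμe : hQQ.eigenvalues = μ ∘ e) :
    ∃ F : X → Fin K → ℝ, ∃ G : Y → Fin K → ℝ,
      IsUnit (Matrix.of fun i j : Fin K => ∑ x, pX x * F x i * F x j).det ∧
      IsUnit (Matrix.of fun i j : Fin K => ∑ y, pY y * G y i * G y j).det ∧
      ((Matrix.of fun i j : Fin K => ∑ x, pX x * F x i * F x j)⁻¹ *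
        (Matrix.of fun i j : Fin K => ∑ x, ∑ y, p x y * F x i * G y j) *
        (Matrix.of fun i j : Fin K => ∑ y, pY y * G y i * G y j)⁻¹ *
        (Matrix.of fun i j : Fin K => ∑ x, ∑ y, p x y * F x i * G y j)ᵀ).trace
      = ∑ k : Fin (Fintype.card X), if (k : ℕ) < K then μ k else 0 := by
  classical
  let u : Fin K → EuclideanSpace ℝ X :=
    fun i => hQQ.eigenvectorBasis (e.symm (Fin.castLE hKX i))
  have hu : ∀ i j, ∑ x, u i x * u j x = if i = j then 1 else 0 := by
    intro i j
    have h := orthonormal_iff_ite.1 hQQ.eigenvectorBasis.orthonormal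
      (e.symm (Fin.castLE hKX j)) (e.symm (Fin.castLE hKX i))
    simp only [PiLp.inner_apply, RCLike.inner_apply, conj_trivial, EmbeddingLike.apply_eq_iff_eq,
      Fin.castLE_inj] at h
    simpa [u, eq_comm] using h
  have hue : ∀ i, (Q * Qᵀ) *ᵥ (u i).ofLp = μ (Fin.castLE hKX i) • (u i).ofLp := by
    intro i
    have h := hQQ.mulVec_eigenvectorBasis (e.symm (Fin.castLE hKX i))
    rw [hμe] at h
    simpa [u] using h
  let f : Fin (Fintype.card Y) → EuclideanSpace ℝ Y := fun k =>
    if h : (k : ℕ) < K then WithLp.toLp 2 (Qᵀ *ᵥ (u ⟨k, h⟩).ofLp) else 0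
  have hcard : Module.finrank ℝ (EuclideanSpace ℝ Y) = Fintype.card (Fin (Fintype.card Y)) := by
    simp
  let b := InnerProductSpace.gramSchmidtOrthonormalBasis hcard f
  have hb : ∀ i j : Fin K, ∑ y, b (Fin.castLE hKY i) y * b (Fin.castLE hKY j) y
      = if i = j then 1 else 0 := by
    intro i j
    have h := orthonormal_iff_ite.1 b.orthonormal (Fin.castLE hKY j) (Fin.castLE hKY i)
    simp only [PiLp.inner_apply, RCLike.inner_apply, conj_trivial, Fin.castLE_inj] at h
    simpa [eq_comm] using h
  have hfi : ∀ i : Fin K, f (Fin.castLE hKY i) = WithLp.toLp 2 (Qᵀ *ᵥ (u i).ofLp) := by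
    intro i
    simp [f]
  have hnorm : ∀ i : Fin K, ‖f (Fin.castLE hKY i)‖ ^ 2 = μ (Fin.castLE hKX i) := by
    intro i
    have h1 : ‖f (Fin.castLE hKY i)‖ ^ 2 = (Qᵀ *ᵥ (u i).ofLp) ⬝ᵥ (Qᵀ *ᵥ (u i).ofLp) := by
      rw [hfi, EuclideanSpace.norm_sq_eq]
      simp [dotProduct, sq]
    have h2 : (u i).ofLp ⬝ᵥ (u i).ofLp = 1 := by
      have := hu i i
      simpa [dotProduct] using this
    rw [h1, Matrix.mulVec_transpose, ← Matrix.dotProduct_mulVec, ← Matrix.mulVec_transpose,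
      Matrix.mulVec_mulVec, hue, dotProduct_smul, h2]
    simp
  have hpars : ∀ i : Fin K, ∑ j : Fin K, (inner ℝ (b (Fin.castLE hKY j)) (f (Fin.castLE hKY i))) ^ 2
      = μ (Fin.castLE hKX i) := by
    intro i
    rw [← hnorm, ← b.sum_sq_norm_inner_right]
    simp only [Real.norm_eq_abs, sq_abs]
    rw [sum_castLE_aux hKY (fun k => (inner ℝ (b k) (f (Fin.castLE hKY i))) ^ 2)]
    refine Finset.sum_congr rfl fun k _ => ?_
    split_ifs with hk
    · rfl
    · have h0 : inner ℝ (b k) (f (Fin.castLE hKY i)) = 0 := by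
        apply InnerProductSpace.gramSchmidtOrthonormalBasis_inv_triangular
        rw [Fin.lt_def]
        simp only [Fin.val_castLE]
        omega
      simp [h0]
  have hsX : ∀ x, Real.sqrt (pX x) ≠ 0 := fun x => (Real.sqrt_pos.2 (hpX_pos x)).ne'
  have hsY : ∀ y, Real.sqrt (pY y) ≠ 0 := fun y => (Real.sqrt_pos.2 (hpY_pos y)).ne'
  refine ⟨fun x i => u i x / Real.sqrt (pX x),
    fun y j => b (Fin.castLE hKY j) y / Real.sqrt (pY y), ?_⟩
  have hRF : (Matrix.of fun i j : Fin K => ∑ x, pX x * (u i x / Real.sqrt (pX x)) *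
      (u j x / Real.sqrt (pX x))) = 1 := by
    ext i j
    rw [Matrix.of_apply, Matrix.one_apply, ← hu]
    refine Finset.sum_congr rfl fun x _ => ?_
    have := hsX x
    have h2 := Real.mul_self_sqrt (hpX_pos x).le
    field_simp
    rw [sq, h2]
    ring
  have hRG : (Matrix.of fun i j : Fin K => ∑ y, pY y *
      (b (Fin.castLE hKY i) y / Real.sqrt (pY y)) *
      (b (Fin.castLE hKY j) y / Real.sqrt (pY y))) = 1 := by
    ext i j
    rw [Matrix.of_apply, Matrix.one_apply, ← hb]
    refine Finset.sum_congr rfl fun y _ => ?_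
    have := hsY y
    have h2 := Real.mul_self_sqrt (hpY_pos y).le
    field_simp
    rw [sq, h2]
    ring
  have hP : (Matrix.of fun i j : Fin K => ∑ x, ∑ y, p x y * (u i x / Real.sqrt (pX x)) *
      (b (Fin.castLE hKY j) y / Real.sqrt (pY y))) =
      Matrix.of fun i j : Fin K => inner ℝ (b (Fin.castLE hKY j)) (f (Fin.castLE hKY i)) := by
    ext i j
    rw [Matrix.of_apply, Matrix.of_apply, hfi]
    simp only [PiLp.inner_apply, RCLike.inner_apply, conj_trivial, mulVec, dotProduct,
      Finset.sum_mul, transpose_apply, hQ]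
    rw [Finset.sum_comm]
    refine Finset.sum_congr rfl fun y _ => Finset.sum_congr rfl fun x _ => ?_
    have := hsX x
    have := hsY y
    field_simp
  rw [hRF, hRG, hP]
  refine ⟨by simp, by simp, ?_⟩
  simp only [inv_one, one_mul, mul_one, Matrix.trace, Matrix.diag, Matrix.mul_apply,
    transpose_apply, Matrix.of_apply, ← sq, hpars]
  exact sum_castLE_aux hKX μ
end

section
/- The matrix Q * Qᵀ is positive semidefinite, 1 - Q * Qᵀ is positive semidefinite (so all eigenvalues of Q * Qᵀ lie in [0, 1]), and the vector u : X → ℝ defined by u x := Real.sqrt (pX x) satisfies (Q * Qᵀ).mulVec u = u, i.e., u is an eigenvector of Q * Qᵀ with eigenvalue 1. -/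
open Matrix

/-- Q * Qᵀ is positive semidefinite, 1 - Q * Qᵀ is positive semidefinite, and
u x := √(pX x) satisfies (Q * Qᵀ).mulVec u = u (eigenvector with eigenvalue 1). -/
theorem QQt_posSemidef_and_sqrt_marginal_eigenvector
    {X Y : Type*} [Fintype X] [Fintype Y] [DecidableEq X] [DecidableEq Y]
    [Nonempty X] [Nonempty Y]
    (p : X → Y → ℝ) (hp_nonneg : ∀ x y, 0 ≤ p x y) (hp_sum : ∑ x, ∑ y, p x y = 1)
    (pX : X → ℝ) (hpX : ∀ x, pX x = ∑ y, p x y)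
    (pY : Y → ℝ) (hpY : ∀ y, pY y = ∑ x, p x y)
    (hpX_pos : ∀ x, 0 < pX x) (hpY_pos : ∀ y, 0 < pY y)
    (Q : Matrix X Y ℝ) (hQ : ∀ x y, Q x y = p x y / (Real.sqrt (pX x) * Real.sqrt (pY y))) :
    (Q * Qᵀ).PosSemidef ∧ (1 - Q * Qᵀ).PosSemidef ∧
      (Q * Qᵀ).mulVec (fun x => Real.sqrt (pX x)) = (fun x => Real.sqrt (pX x)) := by
  have ha : ∀ x, 0 < Real.sqrt (pX x) := fun x => Real.sqrt_pos.2 (hpX_pos x)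
  have hb : ∀ y, 0 < Real.sqrt (pY y) := fun y => Real.sqrt_pos.2 (hpY_pos y)
  have ha2 : ∀ x, Real.sqrt (pX x) ^ 2 = pX x := fun x => Real.sq_sqrt (hpX_pos x).le
  have hb2 : ∀ y, Real.sqrt (pY y) ^ 2 = pY y := fun y => Real.sq_sqrt (hpY_pos y).le
  have h1 : (Q * Qᵀ).PosSemidef := by
    have := Matrix.posSemidef_self_mul_conjTranspose Q
    rwa [Matrix.conjTranspose_eq_transpose_of_trivial] at this
  refine ⟨h1, ?_, ?_⟩
  · refine Matrix.PosSemidef.of_dotProduct_mulVec_nonneg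
      (Matrix.isHermitian_one.sub h1.isHermitian) ?_
    intro v
    have e1 : v ⬝ᵥ ((Q * Qᵀ) *ᵥ v) = ∑ y, (∑ x, Q x y * v x) ^ 2 := by
      rw [← Matrix.mulVec_mulVec, Matrix.dotProduct_mulVec, ← Matrix.mulVec_transpose]
      simp [dotProduct, Matrix.mulVec, sq]
    have key : ∀ y, (∑ x, Q x y * v x) ^ 2 ≤ ∑ x, p x y * (v x ^ 2 / pX x) := by
      intro y
      have := Finset.sum_sq_le_sum_mul_sum_of_sq_eq_mul Finset.univ
        (r := fun x => Q x y * v x) (f := fun x => p x y / pY y)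
        (g := fun x => p x y * (v x ^ 2 / pX x))
        (fun x _ => div_nonneg (hp_nonneg x y) (hpY_pos y).le)
        (fun x _ => mul_nonneg (hp_nonneg x y) (div_nonneg (sq_nonneg _) (hpX_pos x).le))
        (fun x _ => by
          rw [hQ, mul_pow, div_pow, mul_pow, ha2, hb2]
          have := (hpX_pos x).ne'
          have := (hpY_pos y).ne'
          field_simp)
      rwa [← Finset.sum_div, ← hpY, div_self (hpY_pos y).ne', one_mul] at this
    have e2 : ∑ y, ∑ x, p x y * (v x ^ 2 / pX x) = v ⬝ᵥ v := by
      rw [Finset.sum_comm]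
      refine Finset.sum_congr rfl fun x _ => ?_
      rw [← Finset.sum_mul, ← hpX, mul_div_cancel₀ _ (hpX_pos x).ne', sq]
    have := Finset.sum_le_sum fun y (_ : y ∈ Finset.univ) => key y
    rw [star_trivial, Matrix.sub_mulVec, Matrix.one_mulVec, dotProduct_sub, e1, ← e2]
    linarith
  · have f1 : Qᵀ *ᵥ (fun x => Real.sqrt (pX x)) = fun y => Real.sqrt (pY y) := by
      funext y
      have : ∀ x, Q x y * Real.sqrt (pX x) = p x y / Real.sqrt (pY y) := fun x => by
        rw [hQ]
        have := (ha x).ne'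
        have := (hb y).ne'
        field_simp
      simp only [Matrix.mulVec, dotProduct, Matrix.transpose_apply, this]
      rw [← Finset.sum_div, ← hpY, Real.div_sqrt]
    have f2 : Q *ᵥ (fun y => Real.sqrt (pY y)) = fun x => Real.sqrt (pX x) := by
      funext x
      have : ∀ y, Q x y * Real.sqrt (pY y) = p x y / Real.sqrt (pX x) := fun y => by
        rw [hQ]
        have := (ha x).ne'
        have := (hb y).ne'
        field_simp
      simp only [Matrix.mulVec, dotProduct, this]
      rw [← Finset.sum_div, ← hpX, Real.div_sqrt]
    rw [← Matrix.mulVec_mulVec, f1, f2]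
end
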